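/- arXiv:1803.01626 — 2 statements merged into one kernel-verified Lean document; each statement's English description precedes it below -/
import Mathlib

section
/- Let X be a finite nonempty set, let P be a probability distribution on X, and let f : X → ℝ. Define φ_f(λ) = log(Σ_x P(x)·exp(λ·(f(x) − E_P[f]))) for λ ∈ ℝ, its dual φ_{⋆,f}(x) = sup_{λ∈ℝ} (λ·x − φ_f(λ)) (valued in [0,+∞]), and φ_{-,f}^{-1}(t) = sup { x ≤ 0 : φ_{⋆,f}(x) > t }. Then for every probability distribution Q on X with Q ≪ P, one has E_Q[f] − E_P[f] ≥ φ_{-,f}^{-1}(KL(Q,P)). -/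
open Finset

section Defs
variable {X : Type*} [Fintype X]

/-- `P` is a probability distribution on the finite set `X`. -/
def IsDist (P : X → ℝ) : Prop := (∀ x, 0 ≤ P x) ∧ ∑ x, P x = 1

/-- `Q ≪ P`: absolute continuity. -/
def AbsCont (Q P : X → ℝ) : Prop := ∀ x, P x = 0 → Q x = 0

/-- Mean of `f` under `P`. -/
noncomputable def distMean (P f : X → ℝ) : ℝ := ∑ x, P x * f x

/-- Variance of `f` under `P`. -/
noncomputable def distVar (P f : X → ℝ) : ℝ := ∑ x, P x * (f x - distMean P f) ^ 2

/-- Kullback-Leibler divergence `KL(Q,P)`. -/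
noncomputable def distKL (Q P : X → ℝ) : ℝ :=
  ∑ x, if 0 < Q x then Q x * Real.log (Q x / P x) else 0

/-- The local variance `V_{P,Q}(f) = ∑_{x : P(x) ≥ Q(x)} P(x) (f(x) - E_P f)^2`. -/
noncomputable def Vloc (P Q f : X → ℝ) : ℝ :=
  ∑ x, if Q x ≤ P x then P x * (f x - distMean P f) ^ 2 else 0

/-- Span of `f`: `max f - min f`. -/
noncomputable def distSpan [Nonempty X] (f : X → ℝ) : ℝ :=
  univ.sup' univ_nonempty f - univ.inf' univ_nonempty f

end Defs

/-- Log moment generating function `φ_f(λ)` of `f(X) − E_P[f]` for `X ∼ P`. -/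
noncomputable def phiF {X : Type*} [Fintype X] (P f : X → ℝ) (l : ℝ) : ℝ :=
  Real.log (∑ x, P x * Real.exp (l * (f x - distMean P f)))

/-- Legendre dual `φ_{⋆,f}(x) = sup_{λ ∈ ℝ} (λ x − φ_f(λ))`, valued in the extended reals. -/
noncomputable def phiStar (phi : ℝ → ℝ) (x : ℝ) : EReal :=
  ⨆ l : ℝ, ((l * x - phi l : ℝ) : EReal)

/-- `φ_{-,f}^{-1}(t) = sup { x ≤ 0 : φ_{⋆,f}(x) > t }`, valued in the extended reals
(the supremum of the empty set being `−∞`). -/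
noncomputable def phiMinusInv (phi : ℝ → ℝ) (t : ℝ) : EReal :=
  sSup {y : EReal | ∃ x : ℝ, x ≤ 0 ∧ (t : EReal) < phiStar phi x ∧ y = (x : EReal)}

theorem IsDist.sum_mul_exp_pos {X : Type*} [Fintype X] {P : X → ℝ} (hP : IsDist P) (g : X → ℝ) :
    0 < ∑ x, P x * Real.exp (g x) := by
  obtain ⟨x, -, hx⟩ : ∃ x ∈ univ, 0 < P x := by
    by_contra! h
    linarith [sum_nonpos h, hP.2]
  exact Finset.sum_pos' (fun y _ => mul_nonneg (hP.1 y) (Real.exp_pos _).le)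
    ⟨x, mem_univ x, mul_pos hx (Real.exp_pos _)⟩

/-- The easy half of the Donsker–Varadhan variational formula. -/
theorem distMean_sub_log_sum_le_distKL {X : Type*} [Fintype X] {P Q : X → ℝ}
    (hP : IsDist P) (hQ : IsDist Q) (hQP : AbsCont Q P) (g : X → ℝ) :
    distMean Q g - Real.log (∑ x, P x * Real.exp (g x)) ≤ distKL Q P := by
  have hM := hP.sum_mul_exp_pos g
  set M := ∑ x, P x * Real.exp (g x) with hMdef
  have pointwise : ∀ x, Q x * g x - Q x * Real.log M
      - (if 0 < Q x then Q x * Real.log (Q x / P x) else 0) ≤ P x * Real.exp (g x) / M - Q x := by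
    intro x
    split_ifs with h
    · have hPx : 0 < P x := (hP.1 x).lt_of_ne fun h0 => h.ne' (hQP x h0.symm)
      have hlog := Real.log_le_sub_one_of_pos
        (show 0 < P x * Real.exp (g x) / (M * Q x) by positivity)
      rw [Real.log_div (by positivity) (by positivity), Real.log_mul hPx.ne' (by positivity),
        Real.log_mul hM.ne' h.ne', Real.log_exp] at hlog
      rw [Real.log_div h.ne' hPx.ne']
      have hmul := mul_le_mul_of_nonneg_left hlog h.le
      have hcancel : Q x * (P x * Real.exp (g x) / (M * Q x) - 1)
          = P x * Real.exp (g x) / M - Q x := by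
        field_simp
      linarith
    · have hQx : Q x = 0 := le_antisymm (not_lt.mp h) (hQ.1 x)
      have := hP.1 x
      simp only [hQx, zero_mul, sub_zero]
      positivity
  have hsum := Finset.sum_le_sum fun x (_ : x ∈ univ) => pointwise x
  rw [sum_sub_distrib, sum_sub_distrib, sum_sub_distrib, ← sum_mul, ← sum_div, hQ.2, ← hMdef,
    div_self hM.ne'] at hsum
  unfold distMean distKL
  linarith

theorem mul_sub_phiF_le_distKL {X : Type*} [Fintype X] {P Q : X → ℝ}
    (hP : IsDist P) (hQ : IsDist Q) (hQP : AbsCont Q P) (f : X → ℝ) (l : ℝ) :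
    l * (distMean Q f - distMean P f) - phiF P f l ≤ distKL Q P := by
  have hmean : distMean Q (fun x => l * (f x - distMean P f))
      = l * (distMean Q f - distMean P f) := by
    calc distMean Q (fun x => l * (f x - distMean P f))
        = ∑ x, (l * (Q x * f x) - Q x * (l * distMean P f)) :=
          sum_congr rfl fun x _ => by ring
      _ = l * (distMean Q f - distMean P f) := by
          rw [sum_sub_distrib, ← mul_sum, ← sum_mul, hQ.2, one_mul, mul_sub]
          rfl
  rw [← hmean]
  exact distMean_sub_log_sum_le_distKL hP hQ hQP _

theorem IsDist.phiF_zero {X : Type*} [Fintype X] {P : X → ℝ} (hP : IsDist P) (f : X → ℝ) :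
    phiF P f 0 = 0 := by
  simp [phiF, hP.2]

theorem distKL_self {X : Type*} [Fintype X] (P : X → ℝ) : distKL P P = 0 := by
  refine sum_eq_zero fun x _ => ?_
  split_ifs with h
  · rw [div_self h.ne', Real.log_one, mul_zero]
  · rfl

theorem IsDist.phiF_nonneg {X : Type*} [Fintype X] {P : X → ℝ} (hP : IsDist P) (f : X → ℝ)
    (l : ℝ) : 0 ≤ phiF P f l := by
  have h := mul_sub_phiF_le_distKL hP hP (fun _ h => h) f l
  rw [distKL_self] at h
  linarith

theorem distKL_nonneg {X : Type*} [Fintype X] {P Q : X → ℝ}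
    (hP : IsDist P) (hQ : IsDist Q) (hQP : AbsCont Q P) : 0 ≤ distKL Q P := by
  have h := mul_sub_phiF_le_distKL hP hQ hQP 0 0
  rw [hP.phiF_zero] at h
  linarith

/-- Transportation lemma, lower part: for `Q ≪ P`,
`E_Q[f] − E_P[f] ≥ φ_{-,f}^{-1}(KL(Q,P))`. -/
theorem transportation_lower {X : Type*} [Fintype X] [Nonempty X]
    (P Q : X → ℝ) (hP : IsDist P) (hQ : IsDist Q) (hQP : AbsCont Q P) (f : X → ℝ) :
    phiMinusInv (phiF P f) (distKL Q P) ≤ ((distMean Q f - distMean P f : ℝ) : EReal) := by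
  refine sSup_le ?_
  rintro _ ⟨x, hx, hlt, rfl⟩
  obtain ⟨l, hl⟩ := lt_iSup_iff.mp hlt
  rw [EReal.coe_lt_coe_iff] at hl
  rw [EReal.coe_le_coe_iff]
  have hdual := mul_sub_phiF_le_distKL hP hQ hQP f l
  have hneg : l < 0 := by
    by_contra! h
    linarith [mul_nonpos_of_nonneg_of_nonpos h hx, hP.phiF_nonneg f l, distKL_nonneg hP hQ hQP]
  exact (lt_of_mul_lt_mul_of_nonpos_left (by linarith) hneg.le).le
end

section
/- Let X be a finite nonempty set, let P and Q be probability distributions on X with P ≪ Q, and let f : X → ℝ. Then E_Q[f] − E_P[f] ≤ (√(V_{P,Q}(f)) + √(V_{Q,P}(f)))·√(2·KL(P,Q)) + span(f)·KL(P,Q). -/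
open Finset

/-- Cauchy-Schwarz with weights `w`, where `a` vanishes wherever `w` does. -/
theorem sum_mul_le_sqrt_weighted {X : Type*} (S : Finset X) (a w g : X → ℝ)
    (hw : ∀ x ∈ S, 0 ≤ w x) (ha : ∀ x ∈ S, w x = 0 → a x = 0) :
    ∑ x ∈ S, a x * g x ≤
      Real.sqrt (∑ x ∈ S, w x * g x ^ 2) * Real.sqrt (∑ x ∈ S, a x ^ 2 / w x) := by
  rw [← Real.sqrt_mul (Finset.sum_nonneg fun x hx => mul_nonneg (hw x hx) (sq_nonneg _))]
  apply Real.le_sqrt_of_sq_le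
  refine Finset.sum_sq_le_sum_mul_sum_of_sq_le_mul S
    (fun x hx => mul_nonneg (hw x hx) (sq_nonneg _))
    (fun x hx => div_nonneg (sq_nonneg _) (hw x hx)) fun x hx => ?_
  rcases eq_or_ne (w x) 0 with h | h
  · simp [h, ha x hx h]
  · exact le_of_eq (by field_simp)

theorem add_sq_div_two_le_neg_log {t : ℝ} (h0 : 0 ≤ t) (h1 : t < 1) :
    t + t ^ 2 / 2 ≤ -Real.log (1 - t) := by
  have h := Real.hasSum_pow_div_log_of_abs_lt_one (abs_lt.2 ⟨by linarith, h1⟩)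
  have h2 := sum_le_hasSum (Finset.range 2) (fun n _ => by positivity) h
  norm_num [Finset.sum_range_succ] at h2
  linarith

theorem log_le_half_sub_inv {s : ℝ} (hs : 1 ≤ s) : Real.log s ≤ (s - s⁻¹) / 2 := by
  have h := Real.self_le_sinh_iff.2 (Real.log_nonneg hs)
  rwa [Real.sinh_log (by linarith)] at h

/-- The pointwise relative entropy dominates the `χ²`-type term normalised by `p`, for `q ≤ p`. -/
theorem sq_div_le_of_le {p q : ℝ} (hq : 0 < q) (h : q ≤ p) :
    (q - p) ^ 2 / p ≤ 2 * (p * Real.log (p / q) - p + q) := by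
  have hp : 0 < p := hq.trans_le h
  have h1 := add_sq_div_two_le_neg_log (t := 1 - q / p)
    (by rw [sub_nonneg, div_le_one hp]; exact h) (by linarith [div_pos hq hp])
  rw [sub_sub_cancel, ← Real.log_inv, inv_div] at h1
  have h2 := mul_le_mul_of_nonneg_left h1 hp.le
  have e : (q - p) ^ 2 / p = 2 * (p * (1 - q / p + (1 - q / p) ^ 2 / 2) - p + q) := by
    field_simp
    ring
  linarith

/-- The pointwise relative entropy dominates the `χ²`-type term normalised by `q`, for `p ≤ q`. -/
theorem sq_div_le_of_ge {p q : ℝ} (hp : 0 < p) (h : p ≤ q) :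
    (q - p) ^ 2 / q ≤ 2 * (p * Real.log (p / q) - p + q) := by
  have hq : 0 < q := hp.trans_le h
  have h1 := log_le_half_sub_inv ((one_le_div hp).2 h)
  rw [inv_div] at h1
  have h3 : Real.log (p / q) = -Real.log (q / p) := by rw [← Real.log_inv, inv_div]
  have h2 := mul_le_mul_of_nonneg_left h1 hp.le
  have e : (q - p) ^ 2 / q = 2 * (-(p * ((q / p - p / q) / 2)) - p + q) := by
    field_simp
    ring
  rw [h3]
  linarith

theorem sum_sq_div_le_two_mul_distKL {X : Type*} [Fintype X] {P Q : X → ℝ} (hP : IsDist P)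
    (hQ : IsDist Q) (hPQ : AbsCont P Q) :
    ∑ x with Q x ≤ P x, (Q x - P x) ^ 2 / P x + ∑ x with ¬ Q x ≤ P x, (Q x - P x) ^ 2 / Q x ≤
      2 * distKL P Q := by
  have key : ∑ x, (if Q x ≤ P x then (Q x - P x) ^ 2 / P x else (Q x - P x) ^ 2 / Q x) ≤
      ∑ x, 2 * ((if 0 < P x then P x * Real.log (P x / Q x) else 0) - P x + Q x) := by
    refine Finset.sum_le_sum fun x _ => ?_
    rcases (hP.1 x).eq_or_lt' with h | h
    · have hq := hQ.1 x
      simp only [h, lt_irrefl, if_false, div_zero, sub_zero, zero_add]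
      split_ifs
      · linarith
      · rw [sq, mul_self_div_self]
        linarith
    · have hq : 0 < Q x := (hQ.1 x).lt_of_ne' fun h' => h.ne' (hPQ x h')
      rw [if_pos h]
      split_ifs with hc
      · exact sq_div_le_of_le hq hc
      · exact sq_div_le_of_ge h (not_le.1 hc).le
  rwa [Finset.sum_ite, ← Finset.mul_sum, Finset.sum_add_distrib, Finset.sum_sub_distrib, hP.2,
    hQ.2, sub_add_cancel] at key

theorem sum_sub_mul_sub {X : Type*} [Fintype X] {P Q : X → ℝ} (hP : IsDist P) (hQ : IsDist Q)
    (f : X → ℝ) (c : ℝ) :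
    ∑ x, (Q x - P x) * (f x - c) = distMean Q f - distMean P f := by
  have e : ∀ x, (Q x - P x) * (f x - c) = Q x * f x - P x * f x - (Q x - P x) * c := fun x => by
    ring
  simp only [e, Finset.sum_sub_distrib, ← Finset.sum_mul, hP.2, hQ.2, distMean]
  ring

theorem distSpan_nonneg {X : Type*} [Fintype X] [Nonempty X] (f : X → ℝ) : 0 ≤ distSpan f :=
  sub_nonneg.2 ((Finset.inf'_le f (Finset.mem_univ (Classical.arbitrary X))).trans
    (Finset.le_sup' f (Finset.mem_univ _)))

/-- Means differ by at most the span times the total variation distance. -/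
theorem distMean_sub_le_distSpan_mul {X : Type*} [Fintype X] [Nonempty X] {P Q : X → ℝ}
    (hP : IsDist P) (hQ : IsDist Q) (f : X → ℝ) :
    distMean Q f - distMean P f ≤ distSpan f * ∑ x with ¬ Q x ≤ P x, (Q x - P x) := by
  rw [← sum_sub_mul_sub hP hQ f (univ.inf' univ_nonempty f),
    ← Finset.sum_filter_add_sum_filter_not univ (fun x => Q x ≤ P x), Finset.mul_sum]
  have h1 : ∑ x with Q x ≤ P x, (Q x - P x) * (f x - univ.inf' univ_nonempty f) ≤ 0 :=
    Finset.sum_nonpos fun x hx => mul_nonpos_of_nonpos_of_nonneg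
      (sub_nonpos.2 (Finset.mem_filter.1 hx).2)
      (sub_nonneg.2 (Finset.inf'_le f (Finset.mem_univ x)))
  have h2 : ∑ x with ¬ Q x ≤ P x, (Q x - P x) * (f x - univ.inf' univ_nonempty f) ≤
      ∑ x with ¬ Q x ≤ P x, distSpan f * (Q x - P x) := by
    refine Finset.sum_le_sum fun x hx => ?_
    rw [mul_comm]
    exact mul_le_mul_of_nonneg_right
      (sub_le_sub_right (Finset.le_sup' f (Finset.mem_univ x)) _)
      (sub_nonneg.2 (not_le.1 (Finset.mem_filter.1 hx).2).le)
  linarith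

theorem sq_sum_le_sum_sq_div {X : Type*} [Fintype X] {W : X → ℝ} (hW : IsDist W) (S : Finset X)
    (a : X → ℝ) (ha : ∀ x ∈ S, W x = 0 → a x = 0) :
    (∑ x ∈ S, a x) ^ 2 ≤ ∑ x ∈ S, a x ^ 2 / W x := by
  have h : (∑ x ∈ S, a x) ^ 2 ≤ (∑ x ∈ S, W x) * ∑ x ∈ S, a x ^ 2 / W x := by
    refine Finset.sum_sq_le_sum_mul_sum_of_sq_le_mul S (fun x _ => hW.1 x)
      (fun x _ => div_nonneg (sq_nonneg _) (hW.1 x)) fun x hx => ?_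
    rcases eq_or_ne (W x) 0 with h | h
    · simp [h, ha x hx h]
    · exact le_of_eq (by field_simp)
  refine h.trans (mul_le_of_le_one_left
    (Finset.sum_nonneg fun x _ => div_nonneg (sq_nonneg _) (hW.1 x)) ?_)
  rw [← hW.2]
  exact Finset.sum_le_sum_of_subset_of_nonneg (Finset.subset_univ S) fun x _ _ => hW.1 x

/-- The squared total variation distance is at most each of the two `χ²`-type sums. -/
theorem sq_sum_sub_le {X : Type*} [Fintype X] {P Q : X → ℝ} (hP : IsDist P) (hQ : IsDist Q)
    (hPQ : AbsCont P Q) :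
    (∑ x with ¬ Q x ≤ P x, (Q x - P x)) ^ 2 ≤ ∑ x with Q x ≤ P x, (Q x - P x) ^ 2 / P x ∧
    (∑ x with ¬ Q x ≤ P x, (Q x - P x)) ^ 2 ≤ ∑ x with ¬ Q x ≤ P x, (Q x - P x) ^ 2 / Q x := by
  refine ⟨?_, sq_sum_le_sum_sq_div hQ _ _ fun x _ h => by simp [h, hPQ x h]⟩
  have h := Finset.sum_filter_add_sum_filter_not univ (fun x => Q x ≤ P x) fun x => Q x - P x
  have h0 : ∑ x, (Q x - P x) = 0 := by rw [Finset.sum_sub_distrib, hP.2, hQ.2, sub_self]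
  rw [h0] at h
  rw [eq_neg_of_add_eq_zero_right h, neg_sq]
  refine sq_sum_le_sum_sq_div hP _ _ fun x hx h => ?_
  have := hQ.1 x
  have := (Finset.mem_filter.1 hx).2
  linarith

/-- Transportation method II: for `P ≪ Q`,
`E_Q[f] − E_P[f] ≤ (√(V_{P,Q}(f)) + √(V_{Q,P}(f))) √(2 KL(P,Q)) + span(f) KL(P,Q)`. -/
theorem transportation_method_II {X : Type*} [Fintype X] [Nonempty X]
    (P Q : X → ℝ) (hP : IsDist P) (hQ : IsDist Q) (hPQ : AbsCont P Q) (f : X → ℝ) :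
    distMean Q f - distMean P f ≤
      (Real.sqrt (Vloc P Q f) + Real.sqrt (Vloc Q P f)) * Real.sqrt (2 * distKL P Q)
        + distSpan f * distKL P Q := by
  have hA := sum_mul_le_sqrt_weighted {x | Q x ≤ P x} (fun x => Q x - P x) P
    (fun x => f x - distMean P f) (fun x _ => hP.1 x) (fun x hx h => by
      have := hQ.1 x
      have := (Finset.mem_filter.1 hx).2
      linarith)
  have hB := sum_mul_le_sqrt_weighted {x | ¬ Q x ≤ P x} (fun x => Q x - P x) Q
    (fun x => f x - distMean Q f) (fun x _ => hQ.1 x) (fun x _ h => by simp [h, hPQ x h])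
  have hK := sum_sq_div_le_two_mul_distKL hP hQ hPQ
  have hA0 : 0 ≤ ∑ x with Q x ≤ P x, (Q x - P x) ^ 2 / P x :=
    Finset.sum_nonneg fun x _ => div_nonneg (sq_nonneg _) (hP.1 x)
  have hB0 : 0 ≤ ∑ x with ¬ Q x ≤ P x, (Q x - P x) ^ 2 / Q x :=
    Finset.sum_nonneg fun x _ => div_nonneg (sq_nonneg _) (hQ.1 x)
  have hVA : ∑ x with Q x ≤ P x, P x * (f x - distMean P f) ^ 2 = Vloc P Q f :=
    Finset.sum_filter _ _
  have hVB : ∑ x with ¬ Q x ≤ P x, Q x * (f x - distMean Q f) ^ 2 ≤ Vloc Q P f := by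
    rw [Vloc, ← Finset.sum_filter]
    refine Finset.sum_le_sum_of_subset_of_nonneg
      (Finset.monotone_filter_right _ fun x _ h => (not_le.1 h).le)
      fun x _ _ => mul_nonneg (hQ.1 x) (sq_nonneg _)
  rw [hVA] at hA
  set A := ∑ x with Q x ≤ P x, (Q x - P x) ^ 2 / P x
  set B := ∑ x with ¬ Q x ≤ P x, (Q x - P x) ^ 2 / Q x
  set K := distKL P Q
  have hA' := hA.trans (mul_le_mul_of_nonneg_left
    (Real.sqrt_le_sqrt (show A ≤ 2 * K by linarith)) (Real.sqrt_nonneg _))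
  have hB' := hB.trans (mul_le_mul (Real.sqrt_le_sqrt hVB)
    (Real.sqrt_le_sqrt (show B ≤ 2 * K by linarith)) (Real.sqrt_nonneg _) (Real.sqrt_nonneg _))
  obtain ⟨hτA, hτB⟩ := sq_sum_sub_le hP hQ hPQ
  have hτΔ := distMean_sub_le_distSpan_mul hP hQ f
  have hsplit (c : ℝ) : ∑ x with Q x ≤ P x, (Q x - P x) * (f x - c) +
      ∑ x with ¬ Q x ≤ P x, (Q x - P x) * (f x - c) = distMean Q f - distMean P f := by
    rw [Finset.sum_filter_add_sum_filter_not, sum_sub_mul_sub hP hQ]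
  have hshift : ∑ x with ¬ Q x ≤ P x, (Q x - P x) * (f x - distMean P f) =
      ∑ x with ¬ Q x ≤ P x, (Q x - P x) * (f x - distMean Q f) +
        (∑ x with ¬ Q x ≤ P x, (Q x - P x)) * (distMean Q f - distMean P f) := by
    rw [Finset.sum_mul, ← Finset.sum_add_distrib]
    exact Finset.sum_congr rfl fun x _ => by ring
  have hτ0 : 0 ≤ ∑ x with ¬ Q x ≤ P x, (Q x - P x) :=
    Finset.sum_nonneg fun x hx => sub_nonneg.2 (not_le.1 (Finset.mem_filter.1 hx).2).le
  have hm := hsplit (distMean P f)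
  set τ := ∑ x with ¬ Q x ≤ P x, (Q x - P x)
  have h1 := mul_le_mul_of_nonneg_left hτΔ hτ0
  have h2 := mul_le_mul_of_nonneg_left (show τ ^ 2 ≤ K by linarith) (distSpan_nonneg f)
  linarith
end
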